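/- arXiv:2410.01977 — 3 statements merged into one kernel-verified Lean document; each statement's English description precedes it below -/
import Mathlib

section
/- Let R be a commutative ring and C = ⊕_{n∈ℤ} Cⁿ a ℤ-graded R-module equipped, for each integer i ≥ 0, with an R-linear map ψ_i : C → C homogeneous of degree 1 − 2i, satisfying Σ_{i+j=k} ψ_i ∘ ψ_j = 0 for every k ≥ 0. Let C^{S¹} = R[u] ⊗_R C with differential d^{S¹}(u^k ⊗ x) = Σ_{i=0}^{k} u^{k−i} ⊗ ψ_i(x). Then the complex (C, ψ₀) is acyclic if and only if the complex (C^{S¹}, d^{S¹}) is acyclic. -/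
/-!
STATEMENT 1: With `C`, `ψ_i`, `C^{S¹} = R[u] ⊗ C` and
`d^{S¹}(u^k ⊗ x) = Σ_{i=0}^{k} u^{k−i} ⊗ ψ_i x` as in the Gysin setup, the
complex `(C, ψ₀)` is acyclic if and only if `(C^{S¹}, d^{S¹})` is acyclic.
-/


open DirectSum

namespace Stmt1

variable {R : Type*} [CommRing R]

/-- Transport of a graded component along an equality of degrees. -/
def castC {C : ℤ → Type*} [∀ n, AddCommGroup (C n)] [∀ n, Module R (C n)]
    {a b : ℤ} (h : a = b) : C a →ₗ[R] C b := by subst h; exact LinearMap.id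

variable (C : ℤ → Type*) [∀ n, AddCommGroup (C n)] [∀ n, Module R (C n)]

/-- Degree-`n` part of `C^{S¹} = R[u] ⊗ C`: `u^k ⊗ x` with `|x| = n + 2k`. -/
abbrev CS (n : ℤ) : Type _ := ⨁ k : ℕ, C (n + 2 * (k : ℤ))

variable {C}

/-- The equivariant differential `d^{S¹}(u^k ⊗ x) = Σ_{i=0}^{k} u^{k−i} ⊗ ψ_i x`. -/
noncomputable def dS (ψ : ∀ (i : ℕ) (n : ℤ), C n →ₗ[R] C (n + 1 - 2 * (i : ℤ)))
    (n : ℤ) : CS C n →ₗ[R] CS C (n + 1) :=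
  DirectSum.toModule R ℕ (CS C (n + 1)) fun k =>
    ∑ i ∈ (Finset.range (k + 1)).attach,
      (DirectSum.lof R ℕ (fun k' : ℕ => C (n + 1 + 2 * (k' : ℤ))) (k - i.1)) ∘ₗ
        (castC (R := R) (C := C)
          (show n + 2 * (k : ℤ) + 1 - 2 * (i.1 : ℤ) = n + 1 + 2 * ((k - i.1 : ℕ) : ℤ) by
            have := Finset.mem_range.mp i.2; omega)) ∘ₗ
        ψ i.1 (n + 2 * (k : ℤ))

/-- The differential `d = ψ₀` of the complex `C`, recast to land in `C^{n+1}`. -/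
def d0 (ψ : ∀ (i : ℕ) (n : ℤ), C n →ₗ[R] C (n + 1 - 2 * (i : ℤ))) (n : ℤ) :
    C n →ₗ[R] C (n + 1) :=
  (castC (R := R) (C := C) (show n + 1 - 2 * ((0 : ℕ) : ℤ) = n + 1 by omega)) ∘ₗ ψ 0 n

variable (C) in
/-- `ι : x ↦ 1 ⊗ x = u⁰ ⊗ x`. -/
noncomputable def iot (n : ℤ) : C n →ₗ[R] CS C n :=
  (DirectSum.lof R ℕ (fun k : ℕ => C (n + 2 * (k : ℤ))) 0) ∘ₗ
    (castC (R := R) (C := C) (show n = n + 2 * ((0 : ℕ) : ℤ) by omega))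

variable (C) in
/-- `U : u^k ⊗ x ↦ u^{k−1} ⊗ x` (and `1 ⊗ x ↦ 0`), of degree `+2`. -/
noncomputable def Umap (n : ℤ) : CS C n →ₗ[R] CS C (n + 2) :=
  DirectSum.toModule R ℕ (CS C (n + 2)) fun k =>
    match k with
    | 0 => 0
    | (k' + 1) =>
      (DirectSum.lof R ℕ (fun j : ℕ => C (n + 2 + 2 * (j : ℤ))) k') ∘ₗ
        (castC (R := R) (C := C)
          (show n + 2 * ((k' + 1 : ℕ) : ℤ) = n + 2 + 2 * (k' : ℤ) by omega))

variable (R) in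
/-- Cohomology at a two-map spot `M₀ → M₁ → M₂`: `ker(d₂)/im(d₁)`. -/
abbrev spotH {M₀ M₁ M₂ : Type*} [AddCommGroup M₀] [Module R M₀]
    [AddCommGroup M₁] [Module R M₁] [AddCommGroup M₂] [Module R M₂]
    (d1 : M₀ →ₗ[R] M₁) (d2 : M₁ →ₗ[R] M₂) : Type _ :=
  ↥(LinearMap.ker d2) ⧸
    Submodule.comap (LinearMap.ker d2).subtype (LinearMap.range d1)

/-! ### Total versions of the structure maps

To keep degree bookkeeping out of the way, every map is extended by zero to arbitrary pairs of
degrees. -/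

variable (R C) in
/-- The transport `C a → C b` when `a = b`, and zero otherwise. -/
noncomputable def transport (a b : ℤ) : C a →ₗ[R] C b :=
  if h : a = b then castC h else 0

/-- The map `ψ_i : C a → C b` when `b = a + 1 - 2 * i`, and zero otherwise. -/
noncomputable def totalPsi (ψ : ∀ (i : ℕ) (n : ℤ), C n →ₗ[R] C (n + 1 - 2 * (i : ℤ)))
    (i : ℕ) (a b : ℤ) : C a →ₗ[R] C b :=
  transport R C (a + 1 - 2 * (i : ℤ)) b ∘ₗ ψ i a

/-- The differential `d^{S¹} : CS a → CS b` when `b = a + 1`, and zero otherwise. -/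
noncomputable def totalDS (ψ : ∀ (i : ℕ) (n : ℤ), C n →ₗ[R] C (n + 1 - 2 * (i : ℤ)))
    (a b : ℤ) : CS C a →ₗ[R] CS C b :=
  transport R (fun m => CS C m) (a + 1) b ∘ₗ dS ψ a

variable (R C) in
/-- The map `u^k ⊗ x ↦ u^{k-1} ⊗ x`, killing `1 ⊗ x`. -/
noncomputable def lowerU (a b : ℤ) : CS C a →ₗ[R] CS C b :=
  DirectSum.toModule R ℕ (CS C b) fun k =>
    match k with
    | 0 => 0
    | j + 1 => (DirectSum.lof R ℕ (fun k : ℕ => C (b + 2 * (k : ℤ))) j) ∘ₗ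
        transport R C (a + 2 * ((j + 1 : ℕ) : ℤ)) (b + 2 * (j : ℤ))

variable (R C) in
/-- Multiplication by `u`. -/
noncomputable def raiseU (a b : ℤ) : CS C a →ₗ[R] CS C b :=
  DirectSum.toModule R ℕ (CS C b) fun k =>
    (DirectSum.lof R ℕ (fun k : ℕ => C (b + 2 * (k : ℤ))) (k + 1)) ∘ₗ
      transport R C (a + 2 * (k : ℤ)) (b + 2 * ((k + 1 : ℕ) : ℤ))

variable (R C) in
/-- The element `u^k ⊗ x`. -/
noncomputable abbrev monom (a : ℤ) (k : ℕ) : C (a + 2 * (k : ℤ)) →ₗ[R] CS C a :=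
  DirectSum.lof R ℕ (fun k : ℕ => C (a + 2 * (k : ℤ))) k

lemma monom_apply_self (a : ℤ) (k : ℕ) (x : C (a + 2 * (k : ℤ))) : monom R C a k x k = x :=
  DirectSum.of_eq_same (β := fun k : ℕ => C (a + 2 * (k : ℤ))) k x

lemma monom_apply_of_ne (a : ℤ) {j k : ℕ} (h : k ≠ j) (x : C (a + 2 * (j : ℤ))) :
    monom R C a j x k = 0 :=
  DirectSum.of_eq_of_ne (β := fun k : ℕ => C (a + 2 * (k : ℤ))) j k x h

lemma transport_of_eq {a b : ℤ} (h : a = b) : transport R C a b = castC h := dif_pos h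

@[simp] lemma transport_self (a : ℤ) (x : C a) : transport R C a a x = x := by
  rw [transport_of_eq rfl]; rfl

lemma transport_transport {a b c : ℤ} (h : a = b) (x : C a) :
    transport R C b c (transport R C a b x) = transport R C a c x := by
  subst h; simp

section

variable (ψ : ∀ (i : ℕ) (n : ℤ), C n →ₗ[R] C (n + 1 - 2 * (i : ℤ)))

lemma totalPsi_transport {a a' : ℤ} (h : a = a') (i : ℕ) (b : ℤ) (x : C a) :
    totalPsi ψ i a' b (transport R C a a' x) = totalPsi ψ i a b x := by
  subst h; simp

lemma transport_totalPsi {i : ℕ} {a b : ℤ} (h : a + 1 - 2 * (i : ℤ) = b) (c : ℤ) (x : C a) :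
    transport R C b c (totalPsi ψ i a b x) = totalPsi ψ i a c x := by
  simp only [totalPsi, LinearMap.comp_apply, transport_transport h]

lemma castC_comp_d0 {a b : ℤ} (h : a + 1 = b) :
    castC (R := R) h ∘ₗ d0 ψ a = totalPsi ψ 0 a b := by
  subst h
  rw [totalPsi, transport_of_eq (by simp)]
  rfl

lemma d0_eq_totalPsi (a : ℤ) : d0 ψ a = totalPsi ψ 0 a (a + 1) := castC_comp_d0 ψ rfl

lemma castC_comp_dS {a b : ℤ} (h : a + 1 = b) :
    castC (R := R) (C := fun m : ℤ => CS C m) h ∘ₗ dS ψ a = totalDS ψ a b := by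
  rw [totalDS, transport_of_eq h]

lemma dS_eq_totalDS (a : ℤ) : dS ψ a = totalDS ψ a (a + 1) := castC_comp_dS ψ rfl

lemma totalDS_monom {a b : ℤ} (h : a + 1 = b) (k : ℕ) (x : C (a + 2 * (k : ℤ))) :
    totalDS ψ a b (monom R C a k x) =
      ∑ i ∈ Finset.range (k + 1),
        monom R C b (k - i) (totalPsi ψ i _ (b + 2 * ((k - i : ℕ) : ℤ)) x) := by
  subst h
  rw [← dS_eq_totalDS, dS, monom, DirectSum.toModule_lof, LinearMap.sum_apply,
    ← Finset.sum_attach (Finset.range (k + 1))]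
  refine Finset.sum_congr rfl fun i _ => ?_
  have hi := Finset.mem_range.mp i.2
  rw [totalPsi, transport_of_eq (by omega)]
  rfl

lemma totalDS_monom_zero {a b : ℤ} (h : a + 1 = b) (x : C (a + 2 * ((0 : ℕ) : ℤ))) :
    totalDS ψ a b (monom R C a 0 x) = monom R C b 0 (totalPsi ψ 0 _ _ x) := by
  rw [totalDS_monom ψ h]
  simp

@[simp] lemma lowerU_monom_zero (a b : ℤ) (x : C (a + 2 * ((0 : ℕ) : ℤ))) :
    lowerU R C a b (monom R C a 0 x) = 0 := by
  rw [lowerU, monom, DirectSum.toModule_lof]; rfl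

@[simp] lemma lowerU_monom_succ (a b : ℤ) (k : ℕ) (x : C (a + 2 * ((k + 1 : ℕ) : ℤ))) :
    lowerU R C a b (monom R C a (k + 1) x) = monom R C b k (transport R C _ _ x) := by
  rw [lowerU, monom, DirectSum.toModule_lof]; rfl

@[simp] lemma raiseU_monom (a b : ℤ) (k : ℕ) (x : C (a + 2 * (k : ℤ))) :
    raiseU R C a b (monom R C a k x) = monom R C b (k + 1) (transport R C _ _ x) := by
  rw [raiseU, monom, DirectSum.toModule_lof]; rfl

lemma lowerU_raiseU {a b : ℤ} (h : b + 2 = a) (z : CS C a) :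
    lowerU R C b a (raiseU R C a b z) = z := by
  suffices lowerU R C b a ∘ₗ raiseU R C a b = LinearMap.id from LinearMap.congr_fun this z
  refine DirectSum.linearMap_ext R fun k => LinearMap.ext fun x => ?_
  change lowerU R C b a (raiseU R C a b (monom R C a k x)) = monom R C a k x
  rw [raiseU_monom, lowerU_monom_succ, transport_transport (by push_cast; omega), transport_self]

lemma monom_zero_add_raiseU_lowerU {a b : ℤ} (h : a + 2 = b) (z : CS C a) :
    monom R C a 0 (z 0) + raiseU R C b a (lowerU R C a b z) = z := by
  suffices monom R C a 0 ∘ₗ DirectSum.component R ℕ _ 0 + raiseU R C b a ∘ₗ lowerU R C a b =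
    LinearMap.id from LinearMap.congr_fun this z
  refine DirectSum.linearMap_ext R fun k => LinearMap.ext fun x => ?_
  change monom R C a 0 (monom R C a k x 0) + raiseU R C b a (lowerU R C a b (monom R C a k x)) =
    monom R C a k x
  cases k with
  | zero => rw [lowerU_monom_zero, map_zero, add_zero, monom_apply_self]
  | succ k =>
    rw [lowerU_monom_succ, raiseU_monom, transport_transport (by push_cast; omega), transport_self,
      monom_apply_of_ne a (by simp), map_zero, zero_add]

lemma lowerU_apply (a b : ℤ) (z : CS C a) (k : ℕ) :
    lowerU R C a b z k = transport R C _ _ (z (k + 1)) := by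
  suffices DirectSum.component R ℕ _ k ∘ₗ lowerU R C a b =
    transport R C _ _ ∘ₗ DirectSum.component R ℕ _ (k + 1) from LinearMap.congr_fun this z
  refine DirectSum.linearMap_ext R fun j => LinearMap.ext fun x => ?_
  change lowerU R C a b (monom R C a j x) k = transport R C _ _ (monom R C a j x (k + 1))
  cases j with
  | zero =>
    rw [lowerU_monom_zero, monom_apply_of_ne a (by simp), map_zero, DirectSum.zero_apply]
  | succ j =>
    rw [lowerU_monom_succ]
    by_cases hj : j = k
    · subst hj
      rw [monom_apply_self, monom_apply_self]
    · rw [monom_apply_of_ne b (Ne.symm hj), monom_apply_of_ne a (by omega), map_zero]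

lemma lowerU_totalDS {a b a' b' : ℤ} (h : a + 1 = b) (ha : a + 2 = a') (hb : b + 2 = b')
    (z : CS C a) :
    lowerU R C b b' (totalDS ψ a b z) = totalDS ψ a' b' (lowerU R C a a' z) := by
  suffices lowerU R C b b' ∘ₗ totalDS ψ a b = totalDS ψ a' b' ∘ₗ lowerU R C a a' from
    LinearMap.congr_fun this z
  refine DirectSum.linearMap_ext R fun k => LinearMap.ext fun x => ?_
  change lowerU R C b b' (totalDS ψ a b (monom R C a k x)) =
    totalDS ψ a' b' (lowerU R C a a' (monom R C a k x))
  cases k with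
  | zero => rw [totalDS_monom_zero ψ h, lowerU_monom_zero, lowerU_monom_zero, map_zero]
  | succ k =>
    rw [totalDS_monom ψ h, lowerU_monom_succ, totalDS_monom ψ (by omega), map_sum,
      Finset.sum_range_succ, Nat.sub_self, lowerU_monom_zero, add_zero]
    refine Finset.sum_congr rfl fun i hi => ?_
    have hi := Finset.mem_range.mp hi
    rw [Nat.sub_add_comm (by omega : i ≤ k), lowerU_monom_succ,
      transport_totalPsi ψ (by push_cast; omega), totalPsi_transport ψ (by push_cast; omega)]

/-- The relations `∑_{i+j=k} ψ_i ∘ ψ_j = 0`. -/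
def PsiRelations : Prop :=
  ∀ (k : ℕ) (a c : ℤ) (b : ℕ → ℤ) (x : C a),
    (∀ i ≤ k, b i = a + 1 - 2 * (i : ℤ)) → c = a + 2 - 2 * (k : ℤ) →
    ∑ i ∈ Finset.range (k + 1), totalPsi ψ (k - i) (b i) c (totalPsi ψ i a (b i) x) = 0

variable {ψ}

lemma PsiRelations.totalPsi_totalPsi (H : PsiRelations ψ) {a b c : ℤ} (hab : a + 1 = b)
    (hbc : b + 1 = c) (x : C a) : totalPsi ψ 0 b c (totalPsi ψ 0 a b x) = 0 := by
  simpa using H 0 a c (fun _ => b) x (fun i hi => by omega) (by push_cast; omega)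

lemma PsiRelations.totalDS_totalDS (H : PsiRelations ψ) {a b c : ℤ} (hab : a + 1 = b)
    (hbc : b + 1 = c) (z : CS C a) : totalDS ψ b c (totalDS ψ a b z) = 0 := by
  suffices totalDS ψ b c ∘ₗ totalDS ψ a b = 0 from LinearMap.congr_fun this z
  refine DirectSum.linearMap_ext R fun k => LinearMap.ext fun x => ?_
  change totalDS ψ b c (totalDS ψ a b (monom R C a k x)) = 0
  rw [totalDS_monom ψ hab, map_sum]
  have key := Finset.sum_range_diag_flip (k + 1) fun i j => monom R C c (k - i - j)
    (totalPsi ψ j _ (c + 2 * ((k - i - j : ℕ) : ℤ))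
      (totalPsi ψ i _ (b + 2 * ((k - i : ℕ) : ℤ)) x))
  calc
    _ = _ := Finset.sum_congr rfl fun i hi => by
      rw [totalDS_monom ψ hbc, ← Nat.sub_add_comm (Nat.lt_succ_iff.mp (Finset.mem_range.mp hi))]
    _ = _ := key.symm
    _ = 0 := Finset.sum_eq_zero fun l hl => by
      have hl := Finset.mem_range.mp hl
      have := H l _ (c + 2 * ((k - l : ℕ) : ℤ)) (fun i => b + 2 * ((k - i : ℕ) : ℤ)) x
        (fun i hi => by omega) (by omega)
      rw [← (monom R C c (k - l)).map_zero, ← this, map_sum]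
      refine Finset.sum_congr rfl fun i hi => ?_
      have hi := Finset.mem_range.mp hi
      rw [show k - i - (l - i) = k - l by omega]

variable (ψ) in
/-- Every cocycle of `(C, ψ₀)` is a coboundary. -/
def PsiAcyclic : Prop :=
  ∀ a b c : ℤ, a + 1 = b → b + 1 = c → ∀ y : C b, totalPsi ψ 0 b c y = 0 →
    ∃ w : C a, totalPsi ψ 0 a b w = y

variable (ψ) in
/-- Every cocycle of `(C^{S¹}, d^{S¹})` is a coboundary. -/
def DSAcyclic : Prop :=
  ∀ a b c : ℤ, a + 1 = b → b + 1 = c → ∀ y : CS C b, totalDS ψ b c y = 0 →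
    ∃ w : CS C a, totalDS ψ a b w = y

/-- If `u⁻¹ z` is the coboundary of `v`, then `z` differs from the coboundary of `u v` by an
element of the form `1 ⊗ y`. -/
lemma exists_monom_zero_add_totalDS {a b a' b' : ℤ} (h : a + 1 = b) (ha : a + 2 = a')
    (hb : b + 2 = b') {z : CS C b} {v : CS C a'}
    (hv : totalDS ψ a' b' v = lowerU R C b b' z) :
    ∃ y, z = monom R C b 0 y + totalDS ψ a b (raiseU R C a' a v) := by
  set t := z - totalDS ψ a b (raiseU R C a' a v) with ht
  have ht0 : lowerU R C b b' t = 0 := by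
    rw [ht, map_sub, lowerU_totalDS ψ h ha hb, lowerU_raiseU ha, hv, sub_self]
  refine ⟨t 0, ?_⟩
  have := monom_zero_add_raiseU_lowerU (R := R) hb t
  rw [ht0, map_zero, add_zero] at this
  rw [this, ht, sub_add_cancel]

lemma monom_injective (a : ℤ) (k : ℕ) : Function.Injective (monom R C a k) :=
  DirectSum.of_injective (β := fun k : ℕ => C (a + 2 * (k : ℤ))) k

lemma PsiRelations.exists_totalDS_eq_of_bounded (H : PsiRelations ψ) (hC : PsiAcyclic ψ)
    (N : ℕ) : ∀ a b c : ℤ, a + 1 = b → b + 1 = c → ∀ z : CS C b,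
      (∀ k, N ≤ k → z k = 0) → totalDS ψ b c z = 0 → ∃ w : CS C a, totalDS ψ a b w = z := by
  induction N with
  | zero =>
    intro a b c _ _ z hz _
    exact ⟨0, by rw [map_zero]; exact (DFinsupp.ext fun k => hz k k.zero_le).symm⟩
  | succ N ih =>
    intro a b c hab hbc z hz hdz
    obtain ⟨v, hv⟩ := ih (a + 2) (b + 2) (c + 2) (by omega) (by omega)
      (lowerU R C b (b + 2) z)
      (fun k hk => by rw [lowerU_apply, hz _ (by omega), map_zero])
      (by rw [← lowerU_totalDS ψ hbc rfl rfl, hdz, map_zero])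
    obtain ⟨y, hy⟩ := exists_monom_zero_add_totalDS hab rfl rfl hv
    have hdy : totalPsi ψ 0 _ (c + 2 * ((0 : ℕ) : ℤ)) y = 0 := by
      refine monom_injective (R := R) c 0 ?_
      rw [map_zero, ← totalDS_monom_zero ψ hbc, ← hdz, hy, map_add,
        H.totalDS_totalDS hab hbc, add_zero]
    obtain ⟨w, hw⟩ := hC (a + 2 * ((0 : ℕ) : ℤ)) _ _ (by omega) (by omega) y hdy
    refine ⟨monom R C a 0 w + raiseU R C _ a v, ?_⟩
    rw [map_add, totalDS_monom_zero ψ hab, hw, ← hy]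

lemma PsiRelations.dsAcyclic_of_psiAcyclic (H : PsiRelations ψ) (hC : PsiAcyclic ψ) :
    DSAcyclic ψ := by
  classical
  intro a b c hab hbc z hz
  obtain ⟨N, hN⟩ := (DFinsupp.support z).exists_nat_subset_range
  refine H.exists_totalDS_eq_of_bounded hC N a b c hab hbc z (fun k hk => ?_) hz
  by_contra hne
  exact absurd (Finset.mem_range.mp (hN (DFinsupp.mem_support_iff.mpr hne))) (by omega)

lemma PsiRelations.psiAcyclic_of_dsAcyclic (H : PsiRelations ψ) (hS : DSAcyclic ψ) :
    PsiAcyclic ψ := by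
  suffices ∀ a b c : ℤ, a + 1 = b → b + 1 = c → ∀ x : C (b + 2 * ((0 : ℕ) : ℤ)),
      totalPsi ψ 0 _ (c + 2 * ((0 : ℕ) : ℤ)) x = 0 →
      ∃ w : C (a + 2 * ((0 : ℕ) : ℤ)), totalPsi ψ 0 _ _ w = x by
    intro a b c hab hbc
    have e (n : ℤ) : n + 2 * ((0 : ℕ) : ℤ) = n := by simp
    have := this a b c hab hbc
    rwa [e a, e b, e c] at this
  intro a b c hab hbc x hx
  obtain ⟨w, hw⟩ := hS a b c hab hbc (monom R C b 0 x)
    (by rw [totalDS_monom_zero ψ hbc, hx, map_zero])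
  obtain ⟨v, hv⟩ := hS (a - 1 + 2) (a + 2) (b + 2) (by omega) (by omega)
    (lowerU R C a (a + 2) w)
    (by rw [← lowerU_totalDS ψ hab rfl rfl, hw, lowerU_monom_zero])
  obtain ⟨y, hy⟩ := exists_monom_zero_add_totalDS (a := a - 1) (by omega) rfl rfl hv
  refine ⟨y, monom_injective (R := R) b 0 ?_⟩
  rw [← totalDS_monom_zero ψ hab, ← hw, hy, map_add, H.totalDS_totalDS (by omega) hab, add_zero]

end

theorem stmt1 {R : Type*} [CommRing R] (C : ℤ → Type*) [∀ n, AddCommGroup (C n)]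
    [∀ n, Module R (C n)]
    (ψ : ∀ (i : ℕ) (n : ℤ), C n →ₗ[R] C (n + 1 - 2 * (i : ℤ)))
    (hψ : ∀ (k : ℕ) (n : ℤ),
      ∑ i ∈ (Finset.range (k + 1)).attach,
        (castC (R := R) (C := C)
            (show n + 1 - 2 * ((k - i.1 : ℕ) : ℤ) + 1 - 2 * (i.1 : ℤ)
                = n + 2 - 2 * (k : ℤ) by
              have := Finset.mem_range.mp i.2; omega)) ∘ₗ
          (ψ i.1 (n + 1 - 2 * ((k - i.1 : ℕ) : ℤ))) ∘ₗ (ψ (k - i.1) n) = 0) :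
    -- `(C, ψ₀)` is acyclic  ↔  `(C^{S¹}, d^{S¹})` is acyclic
    (∀ n : ℤ, LinearMap.ker (d0 ψ n)
        = LinearMap.range
            ((castC (R := R) (C := C) (show n - 1 + 1 = n by omega)) ∘ₗ d0 ψ (n - 1)))
      ↔
    (∀ n : ℤ, LinearMap.ker (dS ψ n)
        = LinearMap.range
            ((castC (R := R) (C := fun m : ℤ => CS C m) (show n - 1 + 1 = n by omega)) ∘ₗ
              dS ψ (n - 1))) := by
  have H : PsiRelations ψ := by
    intro k a c b x hb hc
    subst hc
    have := LinearMap.congr_fun (hψ k a) x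
    rw [LinearMap.zero_apply, LinearMap.sum_apply] at this
    rw [← this, ← Finset.sum_flip, ← Finset.sum_attach (Finset.range (k + 1))]
    refine Finset.sum_congr rfl fun i _ => ?_
    have hi := Finset.mem_range.mp i.2
    rw [hb _ (Nat.sub_le k i.1), Nat.sub_sub_self (by omega), totalPsi, totalPsi,
      transport_of_eq (by omega), transport_of_eq rfl]
    rfl
  have hleft : (∀ n : ℤ, LinearMap.ker (d0 ψ n) = LinearMap.range
      ((castC (R := R) (C := C) (show n - 1 + 1 = n by omega)) ∘ₗ d0 ψ (n - 1))) ↔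
      PsiAcyclic ψ := by
    simp only [castC_comp_d0]
    simp only [d0_eq_totalPsi]
    constructor
    · rintro h a b c hab rfl y hy
      obtain rfl : a = b - 1 := by omega
      exact (h b).le hy
    · intro h n
      refine le_antisymm (fun y hy => h (n - 1) n (n + 1) (by omega) rfl y hy) ?_
      rintro _ ⟨w, rfl⟩
      exact H.totalPsi_totalPsi (by omega) rfl w
  have hright : (∀ n : ℤ, LinearMap.ker (dS ψ n) = LinearMap.range
      ((castC (R := R) (C := fun m : ℤ => CS C m) (show n - 1 + 1 = n by omega)) ∘ₗ
        dS ψ (n - 1))) ↔ DSAcyclic ψ := by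
    simp only [castC_comp_dS]
    simp only [dS_eq_totalDS]
    constructor
    · rintro h a b c hab rfl y hy
      obtain rfl : a = b - 1 := by omega
      exact (h b).le hy
    · intro h n
      refine le_antisymm (fun y hy => h (n - 1) n (n + 1) (by omega) rfl y hy) ?_
      rintro _ ⟨w, rfl⟩
      exact H.totalDS_totalDS (by omega) rfl w
  rw [hleft, hright]
  exact ⟨H.dsAcyclic_of_psiAcyclic, H.psiAcyclic_of_dsAcyclic⟩

end Stmt1
end

section
/- Let A, B₁, B₂, C be cochain complexes of modules over a commutative ring R, let f₁ : A → B₁, f₂ : A → B₂, g₁ : B₁ → C, g₂ : B₂ → C be chain maps, and let h : A → C be an R-linear map homogeneous of degree −1 with g₁ ∘ f₁ − g₂ ∘ f₂ + d_C ∘ h + h ∘ d_A = 0. If the square is acyclic (i.e., its total complex T is acyclic), then there exist connecting homomorphisms ∂ⁿ : Hⁿ(C) → Hⁿ⁺¹(A) making the Mayer–Vietoris sequence ⋯ → Hⁿ(A) → Hⁿ(B₁) ⊕ Hⁿ(B₂) → Hⁿ(C) →∂ⁿ Hⁿ⁺¹(A) → ⋯ exact, where the first map is a ↦ (H(f₁)a,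 H(f₂)a) and the second is (x, y) ↦ H(g₁)x − H(g₂)y. -/
/-!
STATEMENT 2: Mayer–Vietoris from an acyclic square.  Given cochain complexes
`A, B₁, B₂, C` of `R`-modules, chain maps `f₁ : A → B₁`, `f₂ : A → B₂`,
`g₁ : B₁ → C`, `g₂ : B₂ → C`, and a degree `−1` map `h : A → C` with
`g₁∘f₁ − g₂∘f₂ + d_C∘h + h∘d_A = 0`, if the total complex
`Tⁿ = Aⁿ ⊕ B₁ⁿ⁻¹ ⊕ B₂ⁿ⁻¹ ⊕ Cⁿ⁻²` with
`D(a,b₁,b₂,c) = (d_A a, f₁ a − d_{B₁} b₁, f₂ a − d_{B₂} b₂, h a + g₁ b₁ − g₂ b₂ + d_C c)`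
is acyclic, then there are connecting homomorphisms `∂ⁿ : Hⁿ(C) → Hⁿ⁺¹(A)`
making `⋯ → Hⁿ(A) → Hⁿ(B₁) ⊕ Hⁿ(B₂) → Hⁿ(C) → Hⁿ⁺¹(A) → ⋯` exact, where the
first map is `a ↦ (H(f₁)a, H(f₂)a)` and the second is `(x,y) ↦ H(g₁)x − H(g₂)y`.
-/

namespace Stmt2

variable {R : Type*} [CommRing R]

/-- Transport of a graded component along an equality of degrees. -/
def castC {C : ℤ → Type*} [∀ n, AddCommGroup (C n)] [∀ n, Module R (C n)]
    {a b : ℤ} (h : a = b) : C a →ₗ[R] C b := by subst h; exact LinearMap.id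

variable (R) in
/-- Cohomology at a two-map spot `M₀ → M₁ → M₂`: `ker(d₂)/im(d₁)`. -/
abbrev spotH {M₀ M₁ M₂ : Type*} [AddCommGroup M₀] [Module R M₀]
    [AddCommGroup M₁] [Module R M₁] [AddCommGroup M₂] [Module R M₂]
    (d1 : M₀ →ₗ[R] M₁) (d2 : M₁ →ₗ[R] M₂) : Type _ :=
  ↥(LinearMap.ker d2) ⧸
    Submodule.comap (LinearMap.ker d2).subtype (LinearMap.range d1)

/-- The incoming differential `X^{n−1} → Xⁿ`. -/
def dprev {X : ℤ → Type*} [∀ n, AddCommGroup (X n)] [∀ n, Module R (X n)]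
    (d : ∀ n : ℤ, X n →ₗ[R] X (n + 1)) (n : ℤ) : X (n - 1) →ₗ[R] X n :=
  (castC (R := R) (C := X) (show n - 1 + 1 = n by omega)) ∘ₗ d (n - 1)

/-- `Hⁿ` of the complex `(X, d)`. -/
abbrev Hn {X : ℤ → Type*} [∀ n, AddCommGroup (X n)] [∀ n, Module R (X n)]
    (d : ∀ n : ℤ, X n →ₗ[R] X (n + 1)) (n : ℤ) : Type _ :=
  spotH R (dprev d n) (d n)

variable (A B1 B2 Cc : ℤ → Type*)
  [∀ n, AddCommGroup (A n)] [∀ n, Module R (A n)]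
  [∀ n, AddCommGroup (B1 n)] [∀ n, Module R (B1 n)]
  [∀ n, AddCommGroup (B2 n)] [∀ n, Module R (B2 n)]
  [∀ n, AddCommGroup (Cc n)] [∀ n, Module R (Cc n)]

/-- Degree-`n` part of the total complex of the square:
`Tⁿ = Aⁿ × B₁ⁿ⁻¹ × B₂ⁿ⁻¹ × Cⁿ⁻²`. -/
abbrev TT (n : ℤ) : Type _ := A n × B1 (n - 1) × B2 (n - 1) × Cc (n - 2)

variable {A B1 B2 Cc}

/-- The differential of the total complex:
`D(a,b₁,b₂,c) = (d_A a, f₁ a − d_{B₁} b₁, f₂ a − d_{B₂} b₂, h a + g₁ b₁ − g₂ b₂ + d_C c)`. -/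
def Dtot (dA : ∀ n : ℤ, A n →ₗ[R] A (n + 1)) (dB1 : ∀ n : ℤ, B1 n →ₗ[R] B1 (n + 1))
    (dB2 : ∀ n : ℤ, B2 n →ₗ[R] B2 (n + 1)) (dC : ∀ n : ℤ, Cc n →ₗ[R] Cc (n + 1))
    (f1 : ∀ n : ℤ, A n →ₗ[R] B1 n) (f2 : ∀ n : ℤ, A n →ₗ[R] B2 n)
    (g1 : ∀ n : ℤ, B1 n →ₗ[R] Cc n) (g2 : ∀ n : ℤ, B2 n →ₗ[R] Cc n)
    (h : ∀ n : ℤ, A n →ₗ[R] Cc (n - 1)) (n : ℤ) :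
    TT A B1 B2 Cc n →ₗ[R] TT A B1 B2 Cc (n + 1) :=
  let p1 : TT A B1 B2 Cc n →ₗ[R] A n := LinearMap.fst R (A n) _
  let rest : TT A B1 B2 Cc n →ₗ[R] B1 (n - 1) × B2 (n - 1) × Cc (n - 2) :=
    LinearMap.snd R (A n) _
  let p2 : TT A B1 B2 Cc n →ₗ[R] B1 (n - 1) :=
    (LinearMap.fst R (B1 (n - 1)) _) ∘ₗ rest
  let p3 : TT A B1 B2 Cc n →ₗ[R] B2 (n - 1) :=
    (LinearMap.fst R (B2 (n - 1)) (Cc (n - 2))) ∘ₗ (LinearMap.snd R (B1 (n - 1)) _) ∘ₗ rest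
  let p4 : TT A B1 B2 Cc n →ₗ[R] Cc (n - 2) :=
    (LinearMap.snd R (B2 (n - 1)) (Cc (n - 2))) ∘ₗ (LinearMap.snd R (B1 (n - 1)) _) ∘ₗ rest
  LinearMap.prod (dA n ∘ₗ p1)
    (LinearMap.prod
      ((castC (R := R) (C := B1) (show n = n + 1 - 1 by omega)) ∘ₗ
        (f1 n ∘ₗ p1 - (dprev dB1 n) ∘ₗ p2))
      (LinearMap.prod
        ((castC (R := R) (C := B2) (show n = n + 1 - 1 by omega)) ∘ₗ
          (f2 n ∘ₗ p1 - (dprev dB2 n) ∘ₗ p3))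
        ((castC (R := R) (C := Cc) (show n - 1 = n + 1 - 2 by omega)) ∘ₗ
          (h n ∘ₗ p1 + g1 (n - 1) ∘ₗ p2 - g2 (n - 1) ∘ₗ p3 +
            ((castC (R := R) (C := Cc) (show n - 2 + 1 = n - 1 by omega)) ∘ₗ
              dC (n - 2)) ∘ₗ p4))))

section castC

variable {X : ℤ → Type*} [∀ n, AddCommGroup (X n)] [∀ n, Module R (X n)]
  {Y : ℤ → Type*} [∀ n, AddCommGroup (Y n)] [∀ n, Module R (Y n)]

@[simp]
lemma castC_self {a : ℤ} (e : a = a) (x : X a) : castC (R := R) (C := X) e x = x := rfl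

@[simp]
lemma castC_castC {a b c : ℤ} (e : a = b) (e' : b = c) (x : X a) :
    castC (R := R) (C := X) e' (castC (R := R) (C := X) e x) =
      castC (R := R) (C := X) (e.trans e') x := by
  subst e e'; rfl

/-- A homogeneous family of linear maps commutes with transport of degrees. -/
lemma map_castC {k : ℤ → ℤ} (φ : ∀ n, X n →ₗ[R] Y (k n)) {a b : ℤ} (e : a = b) (x : X a) :
    φ b (castC (R := R) (C := X) e x) =
      castC (R := R) (C := Y) (congrArg k e) (φ a x) := by
  subst e; rfl

end castC

section Cohomology

variable {X : ℤ → Type*} [∀ n, AddCommGroup (X n)] [∀ n, Module R (X n)]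
  {Y : ℤ → Type*} [∀ n, AddCommGroup (Y n)] [∀ n, Module R (Y n)]

lemma dprev_apply (d : ∀ n : ℤ, X n →ₗ[R] X (n + 1)) (n : ℤ) (x : X (n - 1)) :
    dprev d n x = castC (R := R) (C := X) (sub_add_cancel n 1) (d (n - 1) x) := rfl

lemma dprev_succ (d : ∀ n : ℤ, X n →ₗ[R] X (n + 1)) (n : ℤ) (x : X (n + 1 - 1)) :
    dprev d (n + 1) x = d n (castC (R := R) (C := X) (add_sub_cancel_right n 1) x) := by
  rw [dprev_apply, map_castC d]

lemma map_dprev {dX : ∀ n : ℤ, X n →ₗ[R] X (n + 1)} {dY : ∀ n : ℤ, Y n →ₗ[R] Y (n + 1)}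
    {φ : ∀ n : ℤ, X n →ₗ[R] Y n}
    (hφ : ∀ n : ℤ, dY n ∘ₗ φ n = φ (n + 1) ∘ₗ dX n) (n : ℤ) (x : X (n - 1)) :
    φ n (dprev dX n x) = dprev dY n (φ (n - 1) x) := by
  rw [dprev_apply, dprev_apply, map_castC (k := id) φ]
  exact congrArg _ (LinearMap.congr_fun (hφ (n - 1)) x).symm

lemma mk_eq_zero_iff (d : ∀ n : ℤ, X n →ₗ[R] X (n + 1)) {n : ℤ} (x : LinearMap.ker (d n)) :
    (Submodule.Quotient.mk x : Hn d n) = 0 ↔ ∃ w, dprev d n w = x := by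
  rw [Submodule.Quotient.mk_eq_zero]; rfl

lemma mk_eq_mk_iff (d : ∀ n : ℤ, X n →ₗ[R] X (n + 1)) {n : ℤ} (x y : LinearMap.ker (d n)) :
    (Submodule.Quotient.mk x : Hn d n) = Submodule.Quotient.mk y ↔
      ∃ w, dprev d n w = (x : X n) - y := by
  rw [Submodule.Quotient.eq]; rfl

/-- The map induced on cohomology by a chain map. -/
lemma exists_map_Hn {dX : ∀ n : ℤ, X n →ₗ[R] X (n + 1)} {dY : ∀ n : ℤ, Y n →ₗ[R] Y (n + 1)}
    {φ : ∀ n : ℤ, X n →ₗ[R] Y n}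
    (hφ : ∀ n : ℤ, dY n ∘ₗ φ n = φ (n + 1) ∘ₗ dX n) (n : ℤ) :
    ∃ Φ : Hn dX n →ₗ[R] Hn dY n, ∀ (x : LinearMap.ker (dX n)) (y : LinearMap.ker (dY n)),
      (y : Y n) = φ n x → Φ (Submodule.Quotient.mk x) = Submodule.Quotient.mk y := by
  have hker : ∀ x ∈ LinearMap.ker (dX n), φ n x ∈ LinearMap.ker (dY n) := fun x hx ↦ by
    have := LinearMap.congr_fun (hφ n) x
    rw [LinearMap.mem_ker] at hx ⊢
    simpa [hx] using this
  refine ⟨Submodule.mapQ _ _ ((φ n).restrict hker) ?_, fun x y hy ↦ ?_⟩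
  · rintro x ⟨w, hw⟩
    exact ⟨φ (n - 1) w, by rw [← map_dprev hφ, hw]; rfl⟩
  · rw [Submodule.mapQ_apply]
    exact congrArg _ (Subtype.ext hy.symm)

end Cohomology

lemma exists_factor_of_surjective {M N P : Type*} [AddCommGroup M] [Module R M]
    [AddCommGroup N] [Module R N] [AddCommGroup P] [Module R P]
    (p : M →ₗ[R] N) (q : M →ₗ[R] P) (hp : Function.Surjective p)
    (hpq : LinearMap.ker p ≤ LinearMap.ker q) : ∃ δ : N →ₗ[R] P, ∀ z, δ (p z) = q z := by
  refine ⟨(LinearMap.ker p).liftQ q hpq ∘ₗ (p.quotKerEquivOfSurjective hp).symm, fun z ↦ ?_⟩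
  have : (p.quotKerEquivOfSurjective hp).symm (p z) = Submodule.Quotient.mk z := by
    rw [LinearEquiv.symm_apply_eq]; rfl
  rw [LinearMap.comp_apply, LinearEquiv.coe_coe, this, Submodule.liftQ_apply]

section Total

lemma castC_TT {m n : ℤ} (e : m = n) (x : TT A B1 B2 Cc m) :
    castC (R := R) (C := TT A B1 B2 Cc) e x =
      (castC (R := R) (C := A) e x.1,
        castC (R := R) (C := B1) (show m - 1 = n - 1 by rw [e]) x.2.1,
        castC (R := R) (C := B2) (show m - 1 = n - 1 by rw [e]) x.2.2.1,
        castC (R := R) (C := Cc) (show m - 2 = n - 2 by rw [e]) x.2.2.2) := by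
  subst e; rfl

variable {dA : ∀ n : ℤ, A n →ₗ[R] A (n + 1)} {dB1 : ∀ n : ℤ, B1 n →ₗ[R] B1 (n + 1)}
  {dB2 : ∀ n : ℤ, B2 n →ₗ[R] B2 (n + 1)} {dC : ∀ n : ℤ, Cc n →ₗ[R] Cc (n + 1)}
  {f1 : ∀ n : ℤ, A n →ₗ[R] B1 n} {f2 : ∀ n : ℤ, A n →ₗ[R] B2 n}
  {g1 : ∀ n : ℤ, B1 n →ₗ[R] Cc n} {g2 : ∀ n : ℤ, B2 n →ₗ[R] Cc n}
  {h : ∀ n : ℤ, A n →ₗ[R] Cc (n - 1)}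

/-- Acyclicity of the total complex, with the degrees of the components decoupled. -/
lemma exists_primitive
    (hT : ∀ n : ℤ,
      LinearMap.ker (Dtot dA dB1 dB2 dC f1 f2 g1 g2 h n)
        = LinearMap.range
            ((castC (R := R) (C := TT A B1 B2 Cc) (show n - 1 + 1 = n by omega)) ∘ₗ
              Dtot dA dB1 dB2 dC f1 f2 g1 g2 h (n - 1)))
    {q r : ℤ} (hr : r + 1 = q)
    {a : A (q + 1)} {b1 : B1 q} {b2 : B2 q} {c : Cc r}
    (ha : dA (q + 1) a = 0) (hb1 : f1 (q + 1) a = dB1 q b1) (hb2 : f2 (q + 1) a = dB2 q b2)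
    (hc : castC (R := R) (C := Cc) (show q + 1 - 1 = q by omega) (h (q + 1) a) + g1 q b1 - g2 q b2 +
      castC (R := R) (C := Cc) hr (dC r c) = 0) :
    ∃ (a' : A q) (b1' : B1 r) (b2' : B2 r) (c' : Cc (r - 1)),
      dA q a' = a ∧ f1 q a' - castC (R := R) (C := B1) hr (dB1 r b1') = b1 ∧
      f2 q a' - castC (R := R) (C := B2) hr (dB2 r b2') = b2 ∧
      castC (R := R) (C := Cc) (show q - 1 = r by omega) (h q a') + g1 r b1' - g2 r b2' +
        dprev dC r c' = c := by
  have hmem : ((a, castC (R := R) (C := B1) (show q = q + 1 - 1 by omega) b1,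
      castC (R := R) (C := B2) (show q = q + 1 - 1 by omega) b2,
      castC (R := R) (C := Cc) (show r = q + 1 - 2 by omega) c) : TT A B1 B2 Cc (q + 1)) ∈
      LinearMap.ker (Dtot dA dB1 dB2 dC f1 f2 g1 g2 h (q + 1)) := by
    subst hr
    rw [castC_self] at hc
    rw [LinearMap.mem_ker]
    refine Prod.ext ha (Prod.ext ?_ (Prod.ext ?_ ?_))
    · simp [Dtot, dprev_succ, hb1]
    · simp [Dtot, dprev_succ, hb2]
    · have := congrArg (castC (R := R) (C := Cc) (show r + 1 = r + 1 + 1 + 1 - 2 by omega)) hc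
      simpa [Dtot, map_castC (k := id) g1, map_castC (k := id) g2, map_castC dC] using this
  rw [hT] at hmem
  obtain ⟨⟨a', b1', b2', c'⟩, hx⟩ := hmem
  rw [LinearMap.comp_apply, castC_TT] at hx
  simp only [Prod.mk.injEq] at hx
  obtain ⟨h1, h2, h3, h4⟩ := hx
  refine ⟨castC (R := R) (C := A) (show q + 1 - 1 = q by omega) a',
    castC (R := R) (C := B1) (show q + 1 - 1 - 1 = r by omega) b1',
    castC (R := R) (C := B2) (show q + 1 - 1 - 1 = r by omega) b2',
    castC (R := R) (C := Cc) (show q + 1 - 1 - 2 = r - 1 by omega) c', ?_, ?_, ?_, ?_⟩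
  · rw [map_castC dA]; exact h1
  · apply_fun castC (R := R) (C := B1) (show q + 1 - 1 = q by omega) at h2
    simpa [Dtot, dprev_apply, map_castC (k := id) f1, map_castC dB1] using h2
  · apply_fun castC (R := R) (C := B2) (show q + 1 - 1 = q by omega) at h3
    simpa [Dtot, dprev_apply, map_castC (k := id) f2, map_castC dB2] using h3
  · apply_fun castC (R := R) (C := Cc) (show q + 1 - 2 = r by omega) at h4
    simpa [Dtot, dprev_apply, map_castC (k := id) g1, map_castC (k := id) g2, map_castC dC,
      map_castC h] using h4

end Total

theorem stmt2 {R : Type*} [CommRing R] (A B1 B2 Cc : ℤ → Type*)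
    [∀ n, AddCommGroup (A n)] [∀ n, Module R (A n)]
    [∀ n, AddCommGroup (B1 n)] [∀ n, Module R (B1 n)]
    [∀ n, AddCommGroup (B2 n)] [∀ n, Module R (B2 n)]
    [∀ n, AddCommGroup (Cc n)] [∀ n, Module R (Cc n)]
    (dA : ∀ n : ℤ, A n →ₗ[R] A (n + 1)) (dB1 : ∀ n : ℤ, B1 n →ₗ[R] B1 (n + 1))
    (dB2 : ∀ n : ℤ, B2 n →ₗ[R] B2 (n + 1)) (dC : ∀ n : ℤ, Cc n →ₗ[R] Cc (n + 1))
    (hdA : ∀ n : ℤ, (dA (n + 1)) ∘ₗ (dA n) = 0)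
    (hdB1 : ∀ n : ℤ, (dB1 (n + 1)) ∘ₗ (dB1 n) = 0)
    (hdB2 : ∀ n : ℤ, (dB2 (n + 1)) ∘ₗ (dB2 n) = 0)
    (hdC : ∀ n : ℤ, (dC (n + 1)) ∘ₗ (dC n) = 0)
    (f1 : ∀ n : ℤ, A n →ₗ[R] B1 n) (f2 : ∀ n : ℤ, A n →ₗ[R] B2 n)
    (g1 : ∀ n : ℤ, B1 n →ₗ[R] Cc n) (g2 : ∀ n : ℤ, B2 n →ₗ[R] Cc n)
    (hf1 : ∀ n : ℤ, (dB1 n) ∘ₗ (f1 n) = (f1 (n + 1)) ∘ₗ (dA n))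
    (hf2 : ∀ n : ℤ, (dB2 n) ∘ₗ (f2 n) = (f2 (n + 1)) ∘ₗ (dA n))
    (hg1 : ∀ n : ℤ, (dC n) ∘ₗ (g1 n) = (g1 (n + 1)) ∘ₗ (dB1 n))
    (hg2 : ∀ n : ℤ, (dC n) ∘ₗ (g2 n) = (g2 (n + 1)) ∘ₗ (dB2 n))
    (h : ∀ n : ℤ, A n →ₗ[R] Cc (n - 1))
    (hh : ∀ n : ℤ,
      (g1 n) ∘ₗ (f1 n) - (g2 n) ∘ₗ (f2 n) + (dprev dC n) ∘ₗ (h n) +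
        ((castC (R := R) (C := Cc) (show n + 1 - 1 = n by omega)) ∘ₗ (h (n + 1))) ∘ₗ (dA n)
          = 0)
    -- the square is acyclic: its total complex is acyclic
    (hT : ∀ n : ℤ,
      LinearMap.ker (Dtot dA dB1 dB2 dC f1 f2 g1 g2 h n)
        = LinearMap.range
            ((castC (R := R) (C := TT A B1 B2 Cc) (show n - 1 + 1 = n by omega)) ∘ₗ
              Dtot dA dB1 dB2 dC f1 f2 g1 g2 h (n - 1))) :
    ∃ (F : ∀ n : ℤ, Hn dA n →ₗ[R] Hn dB1 n × Hn dB2 n)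
      (G : ∀ n : ℤ, Hn dB1 n × Hn dB2 n →ₗ[R] Hn dC n)
      (δ : ∀ n : ℤ, Hn dC n →ₗ[R] Hn dA (n + 1)),
      -- F is a ↦ (H(f₁) a, H(f₂) a)
      (∀ (n : ℤ) (x : LinearMap.ker (dA n)) (y1 : LinearMap.ker (dB1 n))
          (y2 : LinearMap.ker (dB2 n)),
        (y1 : B1 n) = f1 n (x : A n) → (y2 : B2 n) = f2 n (x : A n) →
          F n (Submodule.Quotient.mk x)
            = (Submodule.Quotient.mk y1, Submodule.Quotient.mk y2)) ∧
      -- G is (x, y) ↦ H(g₁) x − H(g₂) y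
      (∀ (n : ℤ) (y1 : LinearMap.ker (dB1 n)) (y2 : LinearMap.ker (dB2 n))
          (z : LinearMap.ker (dC n)),
        (z : Cc n) = g1 n (y1 : B1 n) - g2 n (y2 : B2 n) →
          G n (Submodule.Quotient.mk y1, Submodule.Quotient.mk y2)
            = Submodule.Quotient.mk z) ∧
      -- exactness of ⋯ → Hⁿ(A) → Hⁿ(B₁) ⊕ Hⁿ(B₂) → Hⁿ(C) → Hⁿ⁺¹(A) → ⋯
      (∀ n : ℤ, Function.Exact (F n) (G n)) ∧
      (∀ n : ℤ, Function.Exact (G n) (δ n)) ∧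
      (∀ n : ℤ, Function.Exact (δ n) (F (n + 1))) := by
  have ef1 n x : dB1 n (f1 n x) = f1 (n + 1) (dA n x) := LinearMap.congr_fun (hf1 n) x
  have ef2 n x : dB2 n (f2 n x) = f2 (n + 1) (dA n x) := LinearMap.congr_fun (hf2 n) x
  have eg1 n x : dC n (g1 n x) = g1 (n + 1) (dB1 n x) := LinearMap.congr_fun (hg1 n) x
  have eg2 n x : dC n (g2 n x) = g2 (n + 1) (dB2 n x) := LinearMap.congr_fun (hg2 n) x
  let k (n : ℤ) : A (n + 1) →ₗ[R] Cc n :=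
    castC (R := R) (C := Cc) (show n + 1 - 1 = n by omega) ∘ₗ h (n + 1)
  have eh n x : g1 n (f1 n x) - g2 n (f2 n x) + dprev dC n (h n x) + k n (dA n x) = 0 :=
    LinearMap.congr_fun (hh n) x
  have ehk n x : dprev dC (n + 1) (h (n + 1) x) = dC n (k n x) := dprev_succ dC n _
  choose F1 hF1 using exists_map_Hn hf1
  choose F2 hF2 using exists_map_Hn hf2
  choose G1 hG1 using exists_map_Hn hg1
  choose G2 hG2 using exists_map_Hn hg2
  have hF (n : ℤ) (x : LinearMap.ker (dA n)) (y1 : LinearMap.ker (dB1 n))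
      (y2 : LinearMap.ker (dB2 n)) (e1 : (y1 : B1 n) = f1 n x) (e2 : (y2 : B2 n) = f2 n x) :
      (F1 n).prod (F2 n) (Submodule.Quotient.mk x) =
        (Submodule.Quotient.mk y1, Submodule.Quotient.mk y2) :=
    Prod.ext (hF1 n x y1 e1) (hF2 n x y2 e2)
  let G (n : ℤ) : Hn dB1 n × Hn dB2 n →ₗ[R] Hn dC n :=
    G1 n ∘ₗ LinearMap.fst R _ _ - G2 n ∘ₗ LinearMap.snd R _ _
  have hG (n : ℤ) (y1 : LinearMap.ker (dB1 n)) (y2 : LinearMap.ker (dB2 n))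
      (z : LinearMap.ker (dC n)) (e : (z : Cc n) = g1 n y1 - g2 n y2) :
      G n (Submodule.Quotient.mk y1, Submodule.Quotient.mk y2) = Submodule.Quotient.mk z := by
    have m1 : dC n (g1 n y1) = 0 := by rw [eg1, LinearMap.mem_ker.1 y1.2, map_zero]
    have m2 : dC n (g2 n y2) = 0 := by rw [eg2, LinearMap.mem_ker.1 y2.2, map_zero]
    have hz : z = ⟨g1 n y1, m1⟩ - ⟨g2 n y2, m2⟩ := Subtype.ext e
    rw [hz, Submodule.Quotient.mk_sub, ← hG1 n y1 ⟨_, m1⟩ rfl, ← hG2 n y2 ⟨_, m2⟩ rfl]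
    rfl
  -- `δ [k a + g₁ b₁ - g₂ b₂] = [a]` whenever `d a = 0`, `f₁ a = d b₁` and `f₂ a = d b₂`
  have hδ (n : ℤ) : ∃ δ : Hn dC n →ₗ[R] Hn dA (n + 1),
      (∀ (a : LinearMap.ker (dA (n + 1))) (b1 : B1 n) (b2 : B2 n) (c : LinearMap.ker (dC n)),
        f1 (n + 1) a = dB1 n b1 → f2 (n + 1) a = dB2 n b2 →
        (c : Cc n) = k n a + g1 n b1 - g2 n b2 →
          δ (Submodule.Quotient.mk c) = Submodule.Quotient.mk a) ∧
      ∀ c : Hn dC n, ∃ (a : LinearMap.ker (dA (n + 1))) (b1 : B1 n) (b2 : B2 n)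
        (z : LinearMap.ker (dC n)), f1 (n + 1) a = dB1 n b1 ∧ f2 (n + 1) a = dB2 n b2 ∧
        (z : Cc n) = k n a + g1 n b1 - g2 n b2 ∧ c = Submodule.Quotient.mk z := by
    let pa : A (n + 1) × B1 n × B2 n →ₗ[R] A (n + 1) := LinearMap.fst R _ _
    let pb1 : A (n + 1) × B1 n × B2 n →ₗ[R] B1 n := LinearMap.fst R _ _ ∘ₗ LinearMap.snd R _ _
    let pb2 : A (n + 1) × B1 n × B2 n →ₗ[R] B2 n := LinearMap.snd R _ _ ∘ₗ LinearMap.snd R _ _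
    let Z : Submodule R (A (n + 1) × B1 n × B2 n) :=
      LinearMap.ker (dA (n + 1) ∘ₗ pa) ⊓
        (LinearMap.ker (f1 (n + 1) ∘ₗ pa - dB1 n ∘ₗ pb1) ⊓
          LinearMap.ker (f2 (n + 1) ∘ₗ pa - dB2 n ∘ₗ pb2))
    have hZ (a b1 b2) : (a, b1, b2) ∈ Z ↔
        dA (n + 1) a = 0 ∧ f1 (n + 1) a = dB1 n b1 ∧ f2 (n + 1) a = dB2 n b2 := by
      simp only [Z, Submodule.mem_inf, LinearMap.mem_ker, LinearMap.sub_apply, sub_eq_zero]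
      rfl
    let s : A (n + 1) × B1 n × B2 n →ₗ[R] Cc n := k n ∘ₗ pa + g1 n ∘ₗ pb1 - g2 n ∘ₗ pb2
    have hs (a b1 b2) : s (a, b1, b2) = k n a + g1 n b1 - g2 n b2 := rfl
    have hsZ : ∀ z ∈ Z, s z ∈ LinearMap.ker (dC n) := by
      rintro ⟨a, b1, b2⟩ hz
      obtain ⟨ha, h1, h2⟩ := (hZ _ _ _).1 hz
      rw [LinearMap.mem_ker, hs, map_sub, map_add, eg1, eg2, ← h1, ← h2, ← ehk]
      have := eh (n + 1) a
      rw [ha, map_zero, add_zero] at this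
      rw [← this]; abel
    have haZ : ∀ z ∈ Z, pa z ∈ LinearMap.ker (dA (n + 1)) := fun z hz ↦ hz.1
    let p : Z →ₗ[R] Hn dC n := Submodule.mkQ _ ∘ₗ s.restrict hsZ
    let q : Z →ₗ[R] Hn dA (n + 1) := Submodule.mkQ _ ∘ₗ pa.restrict haZ
    have hp : Function.Surjective p := by
      intro c
      obtain ⟨c, rfl⟩ := Submodule.Quotient.mk_surjective _ c
      obtain ⟨a, b1, b2, c', e1, e2, e3, e4⟩ := exists_primitive hT (q := n + 1) (r := n) rfl
        (a := 0) (b1 := 0) (b2 := 0) (c := c) (map_zero _) (by simp) (by simp)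
        (by simp)
      refine ⟨⟨(a, b1, b2), (hZ _ _ _).2 ⟨e1, sub_eq_zero.1 e2, sub_eq_zero.1 e3⟩⟩, ?_⟩
      refine (mk_eq_mk_iff dC _ _).2 ⟨-c', ?_⟩
      rw [← e4, map_neg]
      change _ = k n a + g1 n b1 - g2 n b2 - (k n a + g1 n b1 - g2 n b2 + dprev dC n c')
      abel
    have hpq : ∀ z, p z = 0 → q z = 0 := by
      rintro ⟨⟨a, b1, b2⟩, hz⟩ hpz
      obtain ⟨ha, h1, h2⟩ := (hZ _ _ _).1 hz
      obtain ⟨w, hw⟩ := (mk_eq_zero_iff dC _).1 hpz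
      replace hw : dprev dC n w = k n a + g1 n b1 - g2 n b2 := hw
      obtain ⟨a', -, -, -, e1, -⟩ := exists_primitive hT (q := n) (r := n - 1) (by omega)
        (c := -w) ha h1 h2 (by
          change k n a + g1 n b1 - g2 n b2 + _ = 0
          rw [← hw, map_neg, map_neg, dprev_apply, add_neg_cancel])
      refine (mk_eq_zero_iff dA _).2
        ⟨castC (R := R) (C := A) (show n = n + 1 - 1 by omega) a', ?_⟩
      rw [dprev_succ, castC_castC]
      exact e1
    obtain ⟨δ, hδ⟩ := exists_factor_of_surjective p q hp (fun z hz ↦ hpq z hz)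
    refine ⟨δ, fun a b1 b2 c h1 h2 hc ↦ ?_, fun c ↦ ?_⟩
    · have hm := (hZ a b1 b2).2 ⟨a.2, h1, h2⟩
      have : Submodule.Quotient.mk c = p ⟨_, hm⟩ := congrArg _ (Subtype.ext hc)
      rw [this, hδ]
      rfl
    · obtain ⟨⟨⟨a, b1, b2⟩, hz⟩, rfl⟩ := hp c
      obtain ⟨ha, h1, h2⟩ := (hZ _ _ _).1 hz
      exact ⟨⟨a, ha⟩, b1, b2, ⟨_, hsZ _ hz⟩, h1, h2, rfl, rfl⟩
  choose δ hδ hδsurj using hδ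
  refine ⟨fun n ↦ (F1 n).prod (F2 n), G, δ, hF, hG, fun n y ↦ ?_, fun n c ↦ ?_, fun n a ↦ ?_⟩
  · obtain ⟨y1, y2⟩ := y
    constructor
    · obtain ⟨y1, rfl⟩ := Submodule.Quotient.mk_surjective _ y1
      obtain ⟨y2, rfl⟩ := Submodule.Quotient.mk_surjective _ y2
      intro hy
      have hz : dC n (g1 n y1 - g2 n y2) = 0 := by
        rw [map_sub, eg1, eg2, LinearMap.mem_ker.1 y1.2, LinearMap.mem_ker.1 y2.2]
        simp
      rw [hG n y1 y2 ⟨_, hz⟩ rfl, mk_eq_zero_iff] at hy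
      obtain ⟨w, hw⟩ := hy
      replace hw : dprev dC n w = g1 n y1 - g2 n y2 := hw
      obtain ⟨a, b1, b2, -, e1, e2, e3, -⟩ := exists_primitive hT (q := n) (r := n - 1)
        (by omega) (a := 0) (b1 := y1) (b2 := y2) (c := -w) (map_zero _)
        (by simp) (by simp)
        (by rw [map_zero, map_zero, zero_add, ← hw, map_neg, map_neg, dprev_apply,
              add_neg_cancel])
      have m1 : dB1 n (f1 n a) = 0 := by rw [ef1, e1, map_zero]
      have m2 : dB2 n (f2 n a) = 0 := by rw [ef2, e1, map_zero]
      refine ⟨Submodule.Quotient.mk ⟨a, e1⟩, (hF n _ ⟨_, m1⟩ ⟨_, m2⟩ rfl rfl).trans ?_⟩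
      refine Prod.ext ((mk_eq_mk_iff dB1 _ _).2 ⟨b1, ?_⟩) ((mk_eq_mk_iff dB2 _ _).2 ⟨b2, ?_⟩)
      · rw [← e2, dprev_apply, sub_sub_cancel]
      · rw [← e3, dprev_apply, sub_sub_cancel]
    · rintro ⟨x, hx⟩
      obtain ⟨x, rfl⟩ := Submodule.Quotient.mk_surjective _ x
      have hx0 := LinearMap.mem_ker.1 x.2
      have m1 : dB1 n (f1 n x) = 0 := by rw [ef1, hx0, map_zero]
      have m2 : dB2 n (f2 n x) = 0 := by rw [ef2, hx0, map_zero]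
      have hz : dC n (g1 n (f1 n x) - g2 n (f2 n x)) = 0 := by
        rw [map_sub, eg1, eg2, m1, m2]
        simp
      rw [← hx, hF n x ⟨_, m1⟩ ⟨_, m2⟩ rfl rfl]
      refine (hG n _ _ ⟨_, hz⟩ rfl).trans ((mk_eq_zero_iff dC _).2 ⟨-h n x, ?_⟩)
      have := eh n x
      rw [hx0, map_zero, add_zero] at this
      rw [map_neg, neg_eq_iff_add_eq_zero, add_comm]
      exact this
  · constructor
    · obtain ⟨a, b1, b2, z, h1, h2, hz, rfl⟩ := hδsurj n c
      intro hc
      rw [hδ n a b1 b2 z h1 h2 hz, mk_eq_zero_iff] at hc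
      obtain ⟨w, hw⟩ := hc
      rw [dprev_succ] at hw
      set a' := castC (R := R) (C := A) (add_sub_cancel_right n 1) w
      have m1 : dB1 n (b1 - f1 n a') = 0 := by rw [map_sub, ef1, hw, h1, sub_self]
      have m2 : dB2 n (b2 - f2 n a') = 0 := by rw [map_sub, ef2, hw, h2, sub_self]
      have m3 : dC n (g1 n (b1 - f1 n a') - g2 n (b2 - f2 n a')) = 0 := by
        rw [map_sub, eg1, eg2, m1, m2]
        simp
      refine ⟨(Submodule.Quotient.mk ⟨_, m1⟩, Submodule.Quotient.mk ⟨_, m2⟩),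
        (hG n _ _ ⟨_, m3⟩ rfl).trans ((mk_eq_mk_iff dC _ _).2 ⟨h n a', ?_⟩)⟩
      have := eh n a'
      rw [hw] at this
      simp only [hz, map_sub]
      rw [← sub_eq_zero, ← this]
      abel
    · rintro ⟨⟨y1, y2⟩, rfl⟩
      obtain ⟨y1, rfl⟩ := Submodule.Quotient.mk_surjective _ y1
      obtain ⟨y2, rfl⟩ := Submodule.Quotient.mk_surjective _ y2
      have h1 := LinearMap.mem_ker.1 y1.2
      have h2 := LinearMap.mem_ker.1 y2.2
      have hz : dC n (g1 n y1 - g2 n y2) = 0 := by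
        rw [map_sub, eg1, eg2, h1, h2]
        simp
      exact (congrArg (δ n) (hG n y1 y2 ⟨_, hz⟩ rfl)).trans
        (hδ n 0 y1 y2 _ (by simp) (by simp) (by simp))
  · constructor
    · obtain ⟨a, rfl⟩ := Submodule.Quotient.mk_surjective _ a
      intro ha
      have ha0 := LinearMap.mem_ker.1 a.2
      have m1 : dB1 (n + 1) (f1 (n + 1) a) = 0 := by rw [ef1, ha0, map_zero]
      have m2 : dB2 (n + 1) (f2 (n + 1) a) = 0 := by rw [ef2, ha0, map_zero]
      rw [hF (n + 1) a ⟨_, m1⟩ ⟨_, m2⟩ rfl rfl, Prod.mk_eq_zero, mk_eq_zero_iff,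
        mk_eq_zero_iff] at ha
      obtain ⟨⟨w1, hw1⟩, ⟨w2, hw2⟩⟩ := ha
      rw [dprev_succ] at hw1 hw2
      set b1 := castC (R := R) (C := B1) (add_sub_cancel_right n 1) w1
      set b2 := castC (R := R) (C := B2) (add_sub_cancel_right n 1) w2
      have hz : dC n (k n a + g1 n b1 - g2 n b2) = 0 := by
        have := eh (n + 1) a
        rw [ha0, map_zero, add_zero, ehk] at this
        rw [map_sub, map_add, eg1, eg2, hw1, hw2, ← this]
        abel
      exact ⟨_, hδ n a b1 b2 ⟨_, hz⟩ hw1.symm hw2.symm rfl⟩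
    · rintro ⟨c, rfl⟩
      obtain ⟨a, b1, b2, z, h1, h2, hz, rfl⟩ := hδsurj n c
      have ha0 := LinearMap.mem_ker.1 a.2
      have m1 : dB1 (n + 1) (f1 (n + 1) a) = 0 := by rw [ef1, ha0, map_zero]
      have m2 : dB2 (n + 1) (f2 (n + 1) a) = 0 := by rw [ef2, ha0, map_zero]
      rw [hδ n a b1 b2 z h1 h2 hz, hF (n + 1) a ⟨_, m1⟩ ⟨_, m2⟩ rfl rfl, Prod.mk_eq_zero,
        mk_eq_zero_iff, mk_eq_zero_iff]
      refine ⟨⟨castC (R := R) (C := B1) (show n = n + 1 - 1 by omega) b1, ?_⟩,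
        ⟨castC (R := R) (C := B2) (show n = n + 1 - 1 by omega) b2, ?_⟩⟩
      · rw [dprev_succ, castC_castC]
        exact h1.symm
      · rw [dprev_succ, castC_castC]
        exact h2.symm

end Stmt2
end

section
/- Let R be a commutative ring, Δ ∈ ℝ, and T : ℝ → Rˣ a group homomorphism from the additive group of ℝ to the group of units of R (so T(a+b) = T(a)·T(b) and T(0) = 1). Let F be the free R-module on basis elements γ_i (i ∈ ℕ) and β_j (integers j ≥ 1), and let d : F → F be the R-linear map determined by d(γ_i) = 0 and d(β_{i+1}) = T(Δ)·γ_i + T(1−Δ)·γ_{i+1} for all i ∈ ℕ. Then for every n ∈ ℕ: γ_0 + (−1)ⁿ · T((n+1)(1−2Δ)) · γ_{n+1} = d( T(−Δ) · Σ_{i=0}^{n} (−1)^i · T((1−2Δ)·i) · β_{i+1} ). -/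
/-!
STATEMENT 9: Telescoping identity.  `R` a commutative ring, `Δ ∈ ℝ`,
`T : ℝ → Rˣ` a group homomorphism from the additive reals to the units of `R`.
`F` is the free `R`-module on generators `γ_i` (`i ∈ ℕ`, encoded `Sum.inl i`)
and `β_{i+1}` (`i ∈ ℕ`, encoded `Sum.inr i`), and `d : F → F` is the `R`-linear
map with `d γ_i = 0` and `d β_{i+1} = T(Δ)·γ_i + T(1−Δ)·γ_{i+1}`.  Then for all
`n : ℕ`,
`γ_0 + (−1)ⁿ T((n+1)(1−2Δ)) γ_{n+1} = d (T(−Δ) · Σ_{i=0}^{n} (−1)^i T((1−2Δ)i) β_{i+1})`.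
-/

theorem stmt9 {R : Type*} [CommRing R] (Δ : ℝ) (T : ℝ → Rˣ)
    (hT0 : T 0 = 1) (hTadd : ∀ a b : ℝ, T (a + b) = T a * T b)
    (d : ((ℕ ⊕ ℕ) →₀ R) →ₗ[R] ((ℕ ⊕ ℕ) →₀ R))
    (hγ : ∀ i : ℕ, d (Finsupp.single (Sum.inl i) (1 : R)) = 0)
    (hβ : ∀ i : ℕ, d (Finsupp.single (Sum.inr i) (1 : R)) =
      Finsupp.single (Sum.inl i) ((T Δ : Rˣ) : R) +
        Finsupp.single (Sum.inl (i + 1)) ((T (1 - Δ) : Rˣ) : R)) :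
    ∀ n : ℕ,
      Finsupp.single (Sum.inl 0) (1 : R) +
          ((-1 : R) ^ n * ((T (((n : ℝ) + 1) * (1 - 2 * Δ)) : Rˣ) : R)) •
            Finsupp.single (Sum.inl (n + 1)) (1 : R) =
        d (((T (-Δ) : Rˣ) : R) •
            ∑ i ∈ Finset.range (n + 1),
              ((-1 : R) ^ i * ((T ((1 - 2 * Δ) * (i : ℝ)) : Rˣ) : R)) •
                Finsupp.single (Sum.inr i) (1 : R)) := by
  intro n
  have hmul (a b c : ℝ) (h : a + b = c) : (T a : R) * T b = T c := by
    rw [← h, hTadd, Units.val_mul]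
  let s (i : ℕ) : (ℕ ⊕ ℕ) →₀ R :=
    ((-1 : R) ^ i * (T ((1 - 2 * Δ) * (i : ℝ)) : R)) • Finsupp.single (Sum.inl i) (1 : R)
  have step (i : ℕ) :
      (T (-Δ) : R) • ((-1 : R) ^ i * (T ((1 - 2 * Δ) * (i : ℝ)) : R)) •
        d (Finsupp.single (Sum.inr i) (1 : R)) = s i - s (i + 1) := by
    have h₁ : (T (-Δ) : R) * T Δ = 1 := by
      rw [hmul _ _ 0 (by ring), hT0, Units.val_one]
    have h₂ : (T (-Δ) : R) * T (1 - Δ) = T (1 - 2 * Δ) := hmul _ _ _ (by ring)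
    have h₃ : (T ((1 - 2 * Δ) * (i : ℝ)) : R) * T (1 - 2 * Δ) =
        T ((1 - 2 * Δ) * ((i + 1 : ℕ) : ℝ)) := hmul _ _ _ (by push_cast; ring)
    simp only [s, hβ, smul_add, Finsupp.smul_single, smul_eq_mul, mul_one]
    rw [sub_eq_add_neg (Finsupp.single _ _), ← Finsupp.single_neg]
    congr 2
    · linear_combination (-1 : R) ^ i * (T ((1 - 2 * Δ) * (i : ℝ)) : R) * h₁
    · linear_combination (-1 : R) ^ i * (T ((1 - 2 * Δ) * (i : ℝ)) : R) * h₂ + (-1 : R) ^ i * h₃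
  simp only [map_smul, map_sum, Finset.smul_sum, step]
  rw [Finset.sum_range_sub']
  simp only [s, Nat.cast_zero, mul_zero, hT0, Units.val_one, pow_zero, mul_one, one_smul,
    Nat.cast_add, Nat.cast_one, pow_succ, mul_neg, neg_mul, neg_smul, sub_neg_eq_add]
  rw [mul_comm (1 - 2 * Δ)]
end
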